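/- arXiv:2103.10172 — 2 statements merged into one kernel-verified Lean document; each statement's English description precedes it below -/
import Mathlib

section
/- Let T be a finite tree that is an iso-unique zero forcing graph and let 𝒫 be a minimum path cover of T. If e = xy is a connector edge of 𝒫, then either both connector vertices x and y are interior, or one of them is interior and the other is the only vertex of a one-vertex path of 𝒫. -/
/-- The set of vertices that eventually become active in the zero forcing process
started from the set `S`: an active vertex whose neighbors, except exactly one,
are all active, forces the remaining one to become active. -/
inductive ZFClosed {V : Type*} (G : SimpleGraph V) (S : Set V) : V → Prop
  | init (v : V) (hv : v ∈ S) : ZFClosed G S v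
  | force (u v : V) (hu : ZFClosed G S u) (huv : G.Adj u v)
      (hrest : ∀ w : V, G.Adj u w → w ≠ v → ZFClosed G S w) : ZFClosed G S v

/-- `S` is a zero forcing set of `G` if the zero forcing process started at `S`
activates all vertices. -/
def IsZeroForcingSet {V : Type*} (G : SimpleGraph V) (S : Set V) : Prop :=
  ∀ v : V, ZFClosed G S v

/-- A minimum zero forcing set: a zero forcing set of minimum cardinality. -/
def IsMinZeroForcingSet {V : Type*} (G : SimpleGraph V) (S : Set V) : Prop :=
  IsZeroForcingSet G S ∧ ∀ S' : Set V, IsZeroForcingSet G S' → S.ncard ≤ S'.ncard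

/-- `G` is iso-unique zero forcing: any two minimum zero forcing sets are mapped to each
other by some graph automorphism. -/
def IsoUniqueZF {V : Type*} (G : SimpleGraph V) : Prop :=
  ∀ S₁ S₂ : Set V, IsMinZeroForcingSet G S₁ → IsMinZeroForcingSet G S₂ →
    ∃ φ : G ≃g G, ⇑φ '' S₁ = S₂

/-- A nonempty list of distinct vertices forming an induced path of `G`:
consecutive vertices are adjacent and non-consecutive vertices are non-adjacent. -/
def IsInducedPath {V : Type*} (G : SimpleGraph V) (l : List V) : Prop :=
  l ≠ [] ∧ l.Nodup ∧
  (∀ i j : Fin l.length, (i : ℕ) + 1 = (j : ℕ) → G.Adj (l.get i) (l.get j)) ∧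
  (∀ i j : Fin l.length, (i : ℕ) + 1 < (j : ℕ) → ¬ G.Adj (l.get i) (l.get j))

/-- A path cover of `G`: a set of pairwise vertex-disjoint induced paths covering all
vertices of `G`. -/
def IsPathCover {V : Type*} [DecidableEq V] (G : SimpleGraph V) (P : Finset (List V)) : Prop :=
  (∀ l ∈ P, IsInducedPath G l) ∧
  (∀ v : V, ∃ l ∈ P, v ∈ l) ∧
  (∀ l ∈ P, ∀ l' ∈ P, l ≠ l' → ∀ v : V, v ∈ l → v ∉ l')

/-- A minimum path cover: a path cover with the fewest possible number of paths. -/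
def IsMinPathCover {V : Type*} [DecidableEq V] (G : SimpleGraph V)
    (P : Finset (List V)) : Prop :=
  IsPathCover G P ∧ ∀ Q : Finset (List V), IsPathCover G Q → P.card ≤ Q.card

/-- `x` is an interior vertex of some path of the cover `P`, i.e. it belongs to a path
of `P` and is not an end-vertex of that path. -/
def InteriorIn {V : Type*} (P : Finset (List V)) (x : V) : Prop :=
  ∃ l ∈ P, ∃ h : l ≠ [], x ∈ l ∧ x ≠ l.head h ∧ x ≠ l.getLast h

namespace SimpleGraph

variable {V : Type*} {T : SimpleGraph V}

/-- Once a non-backtracking walk in a tree moves away from `r`, it keeps doing so. -/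
theorem IsTree.dist_eq_add_one_of_ne (hT : T.IsTree) {r a b c : V} (hab : T.Adj a b)
    (hbc : T.Adj b c) (hac : a ≠ c) (h : T.dist r b = T.dist r a + 1) :
    T.dist r c = T.dist r b + 1 := by
  rcases hT.dist_eq_dist_add_one_of_adj r hbc with h' | h'
  · exfalso
    obtain ⟨p, hp, hp'⟩ := (hT.connected r a).exists_path_of_dist
    obtain ⟨q, hq, hq'⟩ := (hT.connected r c).exists_path_of_dist
    have h1 : (p.concat hab).IsPath :=
      Walk.isPath_of_length_eq_dist _ (by rw [Walk.length_concat, hp', h])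
    have h2 : (q.concat hbc.symm).IsPath :=
      Walk.isPath_of_length_eq_dist _ (by rw [Walk.length_concat, hq', h'])
    have h3 := congrArg Subtype.val ((hT.isAcyclic.subsingleton_path _ _).elim ⟨_, h1⟩ ⟨_, h2⟩)
    have h4 := congrArg Walk.penultimate h3
    simp only [Walk.penultimate_concat] at h4
    exact hac h4
  · exact h'

theorem IsTree.dist_getElem_of_isChain (hT : T.IsTree) {r : V} (l : List V) :
    ∀ a b : V, (a :: b :: l).IsChain T.Adj → (a :: b :: l).Nodup →
      T.dist r b = T.dist r a + 1 →
      ∀ (i : ℕ) (hi : i < (b :: l).length), T.dist r (b :: l)[i] = T.dist r b + i := by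
  induction l with
  | nil =>
    intro a b _ _ _ i hi
    simp only [List.length_cons, List.length_nil] at hi
    obtain rfl : i = 0 := by omega
    simp
  | cons c l ih =>
    intro a b hc hn h i hi
    cases i with
    | zero => simp
    | succ i =>
      simp only [List.isChain_cons_cons] at hc
      have hac : a ≠ c := by rintro rfl; simp at hn
      have hd := hT.dist_eq_add_one_of_ne hc.1 hc.2.1 hac h
      have := ih b c (by simpa using hc.2) (List.nodup_cons.1 hn).2 hd i (by simpa using hi)
      rw [List.getElem_cons_succ, this, hd]
      ring

theorem IsTree.not_adj_getElem_of_isChain (hT : T.IsTree) (l : List V) (hc : l.IsChain T.Adj)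
    (hn : l.Nodup) (i j : ℕ) (hij : i + 1 < j) (hj : j < l.length) :
    ¬ T.Adj l[i] l[j] := by
  induction l generalizing i j with
  | nil => simp at hj
  | cons a l ih =>
    cases i with
    | succ i =>
      obtain ⟨j, rfl⟩ : ∃ k, j = k + 1 := ⟨j - 1, by omega⟩
      simpa using ih hc.tail (List.nodup_cons.1 hn).2 i j (by omega) (by simpa using hj)
    | zero =>
      obtain ⟨j, rfl⟩ : ∃ k, j = k + 1 := ⟨j - 1, by omega⟩
      cases l with
      | nil => simp at hj
      | cons b l =>
        have hab : T.Adj a b := by simp only [List.isChain_cons_cons] at hc; exact hc.1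
        have h1 : T.dist a b = 1 := dist_eq_one_iff_adj.2 hab
        have := hT.dist_getElem_of_isChain (r := a) l a b hc hn (by simp [h1]) j (by simpa using hj)
        intro h
        simp only [List.getElem_cons_zero, List.getElem_cons_succ] at h
        rw [dist_eq_one_iff_adj.2 h, h1] at this
        omega

theorem IsTree.isInducedPath_iff (hT : T.IsTree) (l : List V) :
    IsInducedPath T l ↔ l ≠ [] ∧ l.Nodup ∧ l.IsChain T.Adj := by
  refine ⟨fun ⟨h0, h1, h2, _⟩ ↦ ⟨h0, h1, ?_⟩, fun ⟨h0, h1, h2⟩ ↦ ⟨h0, h1, ?_, ?_⟩⟩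
  · rw [List.isChain_iff_getElem]
    intro i hi
    exact h2 ⟨i, by omega⟩ ⟨i + 1, hi⟩ rfl
  · rintro ⟨i, hi⟩ ⟨j, hj⟩ h
    obtain rfl : i + 1 = j := h
    exact List.isChain_iff_getElem.1 h2 i hj
  · rintro ⟨i, hi⟩ ⟨j, hj⟩ h
    exact hT.not_adj_getElem_of_isChain l h2 h1 i j h hj

end SimpleGraph

section

variable {V : Type*} {T : SimpleGraph V}

theorem IsInducedPath.index_of_adj {l : List V} (hl : IsInducedPath T l) {i j : ℕ}
    (hi : i < l.length) (hj : j < l.length) (h : T.Adj l[i] l[j]) : i + 1 = j ∨ j + 1 = i := by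
  obtain ⟨-, -, -, h4⟩ := hl
  rcases lt_trichotomy i j with hij | rfl | hij
  · by_contra! hne
    exact h4 ⟨i, hi⟩ ⟨j, hj⟩ (by dsimp only; omega) h
  · exact (T.irrefl h).elim
  · by_contra! hne
    exact h4 ⟨j, hj⟩ ⟨i, hi⟩ (by dsimp only; omega) h.symm

theorem IsInducedPath.reverse (hT : T.IsTree) {l : List V} (hl : IsInducedPath T l) :
    IsInducedPath T l.reverse := by
  rw [hT.isInducedPath_iff] at hl ⊢
  refine ⟨by simpa using hl.1, by simpa using hl.2.1, ?_⟩
  rw [List.isChain_reverse]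
  exact hl.2.2.imp fun _ _ h ↦ h.symm

/-- The front vertex of a path that is not fully activated has an inactive neighbor off the path. -/
theorem exists_adj_not_closed_off_path {S : Set V} {l : List V} (hl : IsInducedPath T l)
    (hhead : ∀ h : l ≠ [], l.head h ∈ S) {k : ℕ} (hk : k < l.length) (hkS : ¬ ZFClosed T S l[k]) :
    ∃ j w', ∃ hj : j < k, T.Adj l[j] w' ∧ ¬ ZFClosed T S w' ∧ w' ∉ l := by
  classical
  have hex : ∃ i, ∃ hi : i < l.length, ¬ ZFClosed T S l[i] := ⟨k, hk, hkS⟩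
  obtain ⟨hm, hmS⟩ := Nat.find_spec hex
  have hmin : ∀ i (hi : i < l.length), i < Nat.find hex → ZFClosed T S l[i] := by
    intro i hi hlt
    by_contra hcon
    exact Nat.find_min hex hlt ⟨hi, hcon⟩
  have hmk : Nat.find hex ≤ k := Nat.find_min' hex ⟨hk, hkS⟩
  generalize Nat.find hex = m at *
  cases m with
  | zero =>
    exfalso
    apply hmS
    have := hhead hl.1
    rw [List.head_eq_getElem] at this
    exact .init _ this
  | succ j =>
    have hadj : T.Adj l[j] l[j + 1] := hl.2.2.1 ⟨j, by omega⟩ ⟨j + 1, hm⟩ rfl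
    by_contra! hcon
    refine hmS (.force _ _ (hmin j (by omega) (by omega)) hadj fun w hw hne ↦ ?_)
    by_contra hwS
    have hwl := hcon j w (by omega) hw hwS
    obtain ⟨i, hi, rfl⟩ := List.getElem_of_mem hwl
    rcases hl.index_of_adj (by omega) hi hw with rfl | h
    · exact hne rfl
    · exact hwS (hmin i hi (by omega))

theorem exists_lt_dist_of_path (hT : T.IsTree) {r u w : V} {l : List V} (hl : IsInducedPath T l)
    (huw : T.Adj u w) (hul : u ∉ l) (hd : T.dist r w = T.dist r u + 1) {k j : ℕ}
    (hk : k < l.length) (hw : l[k] = w) (hj : j < k) {w' : V} (hadj : T.Adj l[j] w')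
    (hw' : w' ∉ l) : T.dist r w' = T.dist r l[j] + 1 ∧ T.dist r w < T.dist r w' := by
  obtain ⟨h0, hn, hc⟩ := (hT.isInducedPath_iff l).1 hl
  set m := (l.take k).reverse with hm
  have hlen : m.length = k := by simp [hm, hk.le]
  have hwm : w :: m = (l.take (k + 1)).reverse := by
    rw [List.take_succ_eq_append_getElem hk, List.reverse_append, hw]
    rfl
  have hchain : (u :: w :: m).IsChain T.Adj := by
    rw [List.isChain_cons_cons]
    refine ⟨huw, ?_⟩
    rw [hwm, List.isChain_reverse]
    exact (hc.take _).imp fun _ _ h ↦ h.symm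
  have hnd : (u :: w :: m).Nodup := by
    rw [List.nodup_cons, hwm]
    refine ⟨fun h ↦ hul ?_, ?_⟩
    · exact List.mem_of_mem_take (List.mem_reverse.1 h)
    · exact List.nodup_reverse.2 (hn.sublist (List.take_sublist _ _))
  have key := hT.dist_getElem_of_isChain (r := r) m u w hchain hnd hd
  have hget : ∀ i (hi : i ≤ k), T.dist r l[i] = T.dist r w + (k - i) := by
    intro i hi
    rw [← key (k - i) (by simp [hlen])]
    congr 1
    simp only [hwm, List.getElem_reverse, List.getElem_take]
    congr 1
    simp
    omega
  have h1 := hget j hj.le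
  have h2 := hget (j + 1) hj
  have h3 : T.Adj l[j + 1] l[j] := (hl.2.2.1 ⟨j, by omega⟩ ⟨j + 1, by omega⟩ rfl).symm
  have h4 := hT.dist_eq_add_one_of_ne (r := r) h3 hadj
    (fun h ↦ hw' (h ▸ List.getElem_mem _)) (by omega)
  omega

variable [Fintype V]

theorem false_of_unbounded_dist (d : V → ℕ) (p : V → V → Prop) (h0 : ∃ u w, p u w)
    (hstep : ∀ u w, p u w → ∃ u' w', p u' w' ∧ d w < d w') : False := by
  have : ∀ n, ∃ u w, p u w ∧ n ≤ d w := by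
    intro n
    induction n with
    | zero => obtain ⟨u, w, h⟩ := h0; exact ⟨u, w, h, Nat.zero_le _⟩
    | succ n ih =>
      obtain ⟨u, w, h, hn⟩ := ih
      obtain ⟨u', w', h', hlt⟩ := hstep u w h
      exact ⟨u', w', h', by omega⟩
  obtain ⟨u, w, -, h⟩ := this (Finset.univ.sup d + 1)
  have := Finset.le_sup (f := d) (Finset.mem_univ w)
  omega

variable [DecidableEq V]

/-- The first vertices of the paths of a path cover of a tree form a zero forcing set. -/
theorem IsPathCover.isZeroForcingSet_heads (hT : T.IsTree) {P : Finset (List V)}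
    (hP : IsPathCover T P) {S : Set V} (hS : ∀ l ∈ P, ∀ h : l ≠ [], l.head h ∈ S) :
    IsZeroForcingSet T S := by
  intro v
  by_contra hv
  obtain ⟨l, hl, hvl⟩ := hP.2.1 v
  obtain ⟨k, hk, rfl⟩ := List.getElem_of_mem hvl
  obtain ⟨j, w, hj, hadj, hw, hwl⟩ := exists_adj_not_closed_off_path (hP.1 l hl) (hS l hl) hk hv
  refine false_of_unbounded_dist (T.dist l[j]) (fun u w ↦ T.Adj u w ∧
    T.dist l[j] w = T.dist l[j] u + 1 ∧ ¬ ZFClosed T S w ∧ ∃ l' ∈ P, w ∈ l' ∧ u ∉ l') ?_ ?_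
  · obtain ⟨l', hl', hwl'⟩ := hP.2.1 w
    refine ⟨l[j], w, hadj, ?_, hw, l', hl', hwl', ?_⟩
    · simp [SimpleGraph.dist_eq_one_iff_adj.2 hadj]
    · exact hP.2.2 l hl l' hl' (by rintro rfl; exact hwl hwl') _ (List.getElem_mem _)
  · rintro u w ⟨huw, hd, hwS, l₁, hl₁, hwl₁, hul₁⟩
    obtain ⟨k, hk, rfl⟩ := List.getElem_of_mem hwl₁
    obtain ⟨i, w', hi, hadj', hw', hwl'⟩ :=
      exists_adj_not_closed_off_path (hP.1 l₁ hl₁) (hS l₁ hl₁) hk hwS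
    have := exists_lt_dist_of_path hT (hP.1 l₁ hl₁) huw hul₁ hd hk rfl hi hadj' hwl'
    obtain ⟨l₂, hl₂, hwl₂⟩ := hP.2.1 w'
    refine ⟨l₁[i], w', ⟨hadj', this.1, hw', l₂, hl₂, hwl₂, ?_⟩, this.2⟩
    exact hP.2.2 l₁ hl₁ l₂ hl₂ (by rintro rfl; exact hwl' hwl₂) _ (List.getElem_mem _)

/-- Following the forces of a zero forcing set of a tree yields a path cover. -/
theorem IsZeroForcingSet.exists_isPathCover (hT : T.IsTree) {S : Set V}
    (hS : IsZeroForcingSet T S) : ∃ Q, IsPathCover T Q ∧ Q.card ≤ S.ncard := by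
  classical
  have extend : ∀ (n : ℕ) (A : Finset V) (Q : Finset (List V)), Aᶜ.card ≤ n → S ⊆ A →
      (∀ l ∈ Q, IsInducedPath T l) → (∀ v, v ∈ A ↔ ∃ l ∈ Q, v ∈ l) →
      (∀ l ∈ Q, ∀ l' ∈ Q, l ≠ l' → ∀ v, v ∈ l → v ∉ l') →
      (∀ l ∈ Q, ∀ u ∈ l.tail, ∀ w, T.Adj u w → w ∈ A) → Q.card ≤ S.ncard →
      ∃ Q, IsPathCover T Q ∧ Q.card ≤ S.ncard := by
    intro n
    induction n with
    | zero =>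
      intro A Q hn hSA h1 h2 h3 _ h5
      refine ⟨Q, ⟨h1, fun v ↦ (h2 v).1 ?_, h3⟩, h5⟩
      have : Aᶜ = ∅ := by simpa using hn
      by_contra hv
      simpa [this] using Finset.mem_compl.2 hv
    | succ n ih =>
      intro A Q hn hSA h1 h2 h3 h4 h5
      by_cases hA : ∀ u ∈ A, ∀ v, T.Adj u v → (∀ w, T.Adj u w → w ≠ v → w ∈ A) → v ∈ A
      · refine ⟨Q, ⟨h1, fun v ↦ (h2 v).1 ?_, h3⟩, h5⟩
        induction hS v with
        | init v hv => exact hSA hv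
        | force u v _ huv _ ihu ihw => exact hA u ihu v huv ihw
      · push Not at hA
        obtain ⟨u, hu, v, huv, hw, hv⟩ := hA
        obtain ⟨l, hl, hul⟩ := (h2 u).1 hu
        obtain ⟨t, rfl⟩ : ∃ t, l = u :: t := by
          cases l with
          | nil => simp at hul
          | cons a t =>
            rcases List.mem_cons.1 hul with rfl | h
            · exact ⟨t, rfl⟩
            · exact (hv (h4 _ hl u h v huv)).elim
        have hvQ : ∀ l ∈ Q, v ∉ l := fun l hl hvl ↦ hv ((h2 v).2 ⟨l, hl, hvl⟩)
        have hdisj : ∀ l ∈ Q, l ≠ u :: t → ∀ w, w ∈ v :: u :: t → w ∉ l := by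
          intro l' hl' hne w hw hwl
          rcases List.mem_cons.1 hw with rfl | hw
          · exact hvQ _ hl' hwl
          · exact h3 _ hl _ hl' hne.symm w hw hwl
        refine ih (insert v A) (insert (v :: u :: t) (Q.erase (u :: t))) ?_ ?_ ?_ ?_ ?_ ?_ ?_
        · rw [Finset.compl_insert, Finset.card_erase_of_mem (by simpa using hv)]
          omega
        · exact hSA.trans (by simp)
        · intro l' hl'
          rcases Finset.mem_insert.1 hl' with rfl | hl'
          · have := (hT.isInducedPath_iff _).1 (h1 _ hl)
            rw [hT.isInducedPath_iff]
            exact ⟨by simp, List.nodup_cons.2 ⟨hvQ _ hl, this.2.1⟩,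
              List.isChain_cons_cons.2 ⟨huv.symm, this.2.2⟩⟩
          · exact h1 _ (Finset.mem_of_mem_erase hl')
        · intro w
          constructor
          · intro hw
            rcases Finset.mem_insert.1 hw with rfl | hw
            · exact ⟨_, Finset.mem_insert_self _ _, by simp⟩
            · obtain ⟨l', hl', hwl'⟩ := (h2 w).1 hw
              by_cases he : l' = u :: t
              · exact ⟨_, Finset.mem_insert_self _ _, List.mem_cons_of_mem _ (he ▸ hwl')⟩
              · exact ⟨l', by simp [he, hl'], hwl'⟩
          · rintro ⟨l', hl', hwl'⟩
            rcases Finset.mem_insert.1 hl' with rfl | hl'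
            · rcases List.mem_cons.1 hwl' with rfl | h
              · simp
              · exact Finset.mem_insert_of_mem ((h2 w).2 ⟨_, hl, h⟩)
            · exact Finset.mem_insert_of_mem ((h2 w).2 ⟨_, Finset.mem_of_mem_erase hl', hwl'⟩)
        · intro l₁ hl₁ l₂ hl₂ hne w hw₁ hw₂
          rcases Finset.mem_insert.1 hl₁ with rfl | hl₁ <;>
            rcases Finset.mem_insert.1 hl₂ with rfl | hl₂
          · exact hne rfl
          · exact hdisj _ (Finset.mem_of_mem_erase hl₂) (Finset.ne_of_mem_erase hl₂) w hw₁ hw₂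
          · exact hdisj _ (Finset.mem_of_mem_erase hl₁) (Finset.ne_of_mem_erase hl₁) w hw₂ hw₁
          · exact h3 _ (Finset.mem_of_mem_erase hl₁) _ (Finset.mem_of_mem_erase hl₂) hne w hw₁ hw₂
        · intro l' hl' x hx w hxw
          rcases Finset.mem_insert.1 hl' with rfl | hl'
          · by_cases hwv : w = v
            · simp [hwv]
            · refine Finset.mem_insert_of_mem ?_
              rcases List.mem_cons.1 hx with rfl | hx
              · exact hw w hxw hwv
              · exact h4 _ hl x hx w hxw
          · exact Finset.mem_insert_of_mem (h4 _ (Finset.mem_of_mem_erase hl') x hx w hxw)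
        · refine (Finset.card_insert_le _ _).trans ?_
          rw [Finset.card_erase_of_mem hl]
          have := Finset.card_pos.2 ⟨_, hl⟩
          omega
  refine extend _ S.toFinset (S.toFinset.image fun v ↦ [v]) le_rfl (by simp) ?_ (by simp) ?_ ?_ ?_
  · simp [hT.isInducedPath_iff]
  · simp +contextual [eq_comm]
  · simp
  · exact Finset.card_image_le.trans (by rw [Set.ncard_eq_toFinset_card'])

omit [Fintype V] in
/-- Some paths of a path cover may be replaced by other paths on the same vertices. -/
theorem IsPathCover.exchange {P R R' : Finset (List V)} (hP : IsPathCover T P) (hR : R ⊆ P)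
    (hind : ∀ l ∈ R', IsInducedPath T l)
    (hdisj : ∀ l ∈ R', ∀ l' ∈ R', l ≠ l' → ∀ v, v ∈ l → v ∉ l')
    (hmem : ∀ v, (∃ l ∈ R', v ∈ l) ↔ ∃ l ∈ R, v ∈ l) :
    IsPathCover T (P \ R ∪ R') ∧ Disjoint (P \ R) R' := by
  have hcross : ∀ l ∈ P \ R, ∀ l' ∈ R', ∀ v, v ∈ l → v ∉ l' := by
    intro l hl l' hl' v hvl hvl'
    rw [Finset.mem_sdiff] at hl
    obtain ⟨l₂, hl₂, hvl₂⟩ := (hmem v).1 ⟨l', hl', hvl'⟩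
    exact hP.2.2 l hl.1 l₂ (hR hl₂) (by rintro rfl; exact hl.2 hl₂) v hvl hvl₂
  refine ⟨⟨?_, ?_, ?_⟩, ?_⟩
  · intro l hl
    rcases Finset.mem_union.1 hl with hl | hl
    · exact hP.1 l (Finset.mem_sdiff.1 hl).1
    · exact hind l hl
  · intro v
    obtain ⟨l, hl, hvl⟩ := hP.2.1 v
    by_cases hlR : l ∈ R
    · obtain ⟨l', hl', hvl'⟩ := (hmem v).2 ⟨l, hlR, hvl⟩
      exact ⟨l', Finset.mem_union_right _ hl', hvl'⟩
    · exact ⟨l, Finset.mem_union_left _ (Finset.mem_sdiff.2 ⟨hl, hlR⟩), hvl⟩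
  · intro l hl l' hl' hne v hvl hvl'
    rcases Finset.mem_union.1 hl with hl | hl <;> rcases Finset.mem_union.1 hl' with hl' | hl'
    · exact hP.2.2 l (Finset.mem_sdiff.1 hl).1 l' (Finset.mem_sdiff.1 hl').1 hne v hvl hvl'
    · exact hcross l hl l' hl' v hvl hvl'
    · exact hcross l' hl' l hl v hvl' hvl
    · exact hdisj l hl l' hl' hne v hvl hvl'
  · rw [Finset.disjoint_left]
    intro l hl hl'
    obtain ⟨v, hv⟩ := List.exists_mem_of_ne_nil l (hind l hl').1
    exact hcross l hl l hl' v hv hv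

omit [Fintype V] in
theorem IsPathCover.injOn_headD {P : Finset (List V)} (hP : IsPathCover T P) (r : V) :
    Set.InjOn (fun l : List V ↦ l.headD r) P := by
  have hmem : ∀ l ∈ P, l.headD r ∈ l := by
    intro l hl
    cases l with
    | nil => exact ((hP.1 _ hl).1 rfl).elim
    | cons a t => simp
  intro l hl l' hl' h
  by_contra hne
  refine hP.2.2 l hl l' hl' hne _ (hmem l hl) ?_
  have h' : l.headD r = l'.headD r := h
  exact h' ▸ hmem l' hl'

theorem IsMinPathCover.isMinZeroForcingSet_heads (hT : T.IsTree) {P : Finset (List V)}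
    (hP : IsMinPathCover T P) (r : V) :
    IsMinZeroForcingSet T (P.image fun l ↦ l.headD r : Finset V) := by
  refine ⟨hP.1.isZeroForcingSet_heads hT ?_, fun S hS ↦ ?_⟩
  · intro l hl h
    obtain ⟨a, t, rfl⟩ := List.exists_cons_of_ne_nil h
    simpa using ⟨_, hl, rfl⟩
  · obtain ⟨Q, hQ, hcard⟩ := hS.exists_isPathCover hT
    rw [Set.ncard_coe_finset]
    exact Finset.card_image_le.trans ((hP.2 Q hQ).trans hcard)

variable [DecidableRel T.Adj]

theorem IsoUniqueZF.sum_degree_headD_eq (hT : T.IsTree) (hiso : IsoUniqueZF T)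
    {P Q : Finset (List V)} (hP : IsMinPathCover T P) (hQ : IsMinPathCover T Q) (r : V) :
    ∑ l ∈ P, T.degree (l.headD r) = ∑ l ∈ Q, T.degree (l.headD r) := by
  obtain ⟨φ, hφ⟩ := hiso _ _ (hP.isMinZeroForcingSet_heads hT r) (hQ.isMinZeroForcingSet_heads hT r)
  have h : (P.image fun l ↦ l.headD r).image φ = Q.image fun l ↦ l.headD r := by
    rw [← Finset.coe_inj, Finset.coe_image, hφ]
  calc ∑ l ∈ P, T.degree (l.headD r)
      = ∑ v ∈ P.image fun l ↦ l.headD r, T.degree v :=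
        (Finset.sum_image (f := fun v ↦ T.degree v) (hP.1.injOn_headD r)).symm
    _ = ∑ v ∈ (P.image fun l ↦ l.headD r).image φ, T.degree v := by
        rw [Finset.sum_image φ.injective.injOn]
        exact Finset.sum_congr rfl fun v _ ↦ (φ.degree_eq v).symm
    _ = ∑ l ∈ Q, T.degree (l.headD r) := by
        rw [h, Finset.sum_image (f := fun v ↦ T.degree v) (hQ.1.injOn_headD r)]

theorem IsoUniqueZF.sum_degree_exchange (hT : T.IsTree) (hiso : IsoUniqueZF T)
    {P R R' : Finset (List V)} (hP : IsMinPathCover T P) (hR : R ⊆ P)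
    (hind : ∀ l ∈ R', IsInducedPath T l)
    (hdisj : ∀ l ∈ R', ∀ l' ∈ R', l ≠ l' → ∀ v, v ∈ l → v ∉ l')
    (hmem : ∀ v, (∃ l ∈ R', v ∈ l) ↔ ∃ l ∈ R, v ∈ l) (hcard : R'.card ≤ R.card) (r : V) :
    ∑ l ∈ R', T.degree (l.headD r) = ∑ l ∈ R, T.degree (l.headD r) := by
  obtain ⟨hQ, hd⟩ := hP.1.exchange hR hind hdisj hmem
  have hQmin : IsMinPathCover T (P \ R ∪ R') := by
    refine ⟨hQ, fun Q' hQ' ↦ le_trans ?_ (hP.2 Q' hQ')⟩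
    have h1 := Finset.card_sdiff_add_card_eq_card hR
    have h2 := Finset.card_union_le (P \ R) R'
    omega
  have h := hiso.sum_degree_headD_eq hT hP hQmin r
  rw [Finset.sum_union hd, ← Finset.sum_sdiff hR] at h
  omega

theorem IsoUniqueZF.degree_headD_reverse (hT : T.IsTree) (hiso : IsoUniqueZF T)
    {P : Finset (List V)} (hP : IsMinPathCover T P) {l : List V} (hl : l ∈ P) (r : V) :
    T.degree (l.reverse.headD r) = T.degree (l.headD r) := by
  simpa using hiso.sum_degree_exchange hT hP (R := {l}) (R' := {l.reverse}) (by simpa using hl)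
    (by simpa using (hP.1.1 l hl).reverse hT) (by simp) (by simp) (by simp) r

omit [Fintype V] [DecidableRel T.Adj] in
theorem IsMinPathCover.not_adj_ends (hT : T.IsTree) {P : Finset (List V)}
    (hP : IsMinPathCover T P) {lx ly s t : List V} {x y : V} (hlx : lx ∈ P) (hly : ly ∈ P)
    (hne : lx ≠ ly) (hx : s ++ [x] = lx ∨ s ++ [x] = lx.reverse)
    (hy : y :: t = ly ∨ y :: t = ly.reverse) : ¬ T.Adj x y := by
  intro hxy
  have hxmem : ∀ v, v ∈ s ++ [x] ↔ v ∈ lx := by rcases hx with h | h <;> simp [h]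
  have hymem : ∀ v, v ∈ y :: t ↔ v ∈ ly := by rcases hy with h | h <;> simp [h]
  have hix : IsInducedPath T (s ++ [x]) := by
    rcases hx with h | h <;> rw [h]
    exacts [hP.1.1 _ hlx, (hP.1.1 _ hlx).reverse hT]
  have hiy : IsInducedPath T (y :: t) := by
    rcases hy with h | h <;> rw [h]
    exacts [hP.1.1 _ hly, (hP.1.1 _ hly).reverse hT]
  rw [hT.isInducedPath_iff] at hix hiy
  have hind : IsInducedPath T (s ++ x :: y :: t) := by
    rw [hT.isInducedPath_iff]
    refine ⟨by simp, ?_, List.isChain_append_cons_cons.2 ⟨hix.2.2, hxy, hiy.2.2⟩⟩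
    have : (s ++ [x] ++ y :: t).Nodup :=
      hix.2.1.append hiy.2.1 fun v hv hv' ↦
        hP.1.2.2 lx hlx ly hly hne v ((hxmem v).1 hv) ((hymem v).1 hv')
    simpa using this
  have hQ := (hP.1.exchange (R := {lx, ly}) (R' := {s ++ x :: y :: t})
    (by simp [Finset.insert_subset_iff, hlx, hly]) (by simpa using hind) (by simp) (by
      intro v
      have h1 := hxmem v
      have h2 := hymem v
      simp only [List.mem_append, List.mem_cons, List.not_mem_nil, or_false] at h1 h2
      simp [← h1, ← h2, or_assoc])).1
  have h1 := hP.2 _ hQ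
  have h2 := Finset.card_union_le (P \ {lx, ly}) {s ++ x :: y :: t}
  have h3 := Finset.card_sdiff_add_card_eq_card (s := {lx, ly}) (t := P)
    (by simp [Finset.insert_subset_iff, hlx, hly])
  rw [Finset.card_pair hne] at h3
  rw [Finset.card_singleton] at h2
  omega

theorem IsoUniqueZF.degree_last_eq (hT : T.IsTree) (hiso : IsoUniqueZF T)
    {P : Finset (List V)} (hP : IsMinPathCover T P) {A B ly t : List V} {x y : V}
    (hA : A ≠ []) (hB : B ≠ []) (hlx : A ++ x :: B ∈ P) (hly : ly ∈ P)
    (hne : A ++ x :: B ≠ ly) (hy : y :: t = ly ∨ y :: t = ly.reverse) (hxy : T.Adj x y) (r : V) :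
    T.degree ((A ++ x :: B).reverse.headD r) = T.degree y := by
  have hymem : ∀ v, v ∈ y :: t ↔ v ∈ ly := by rcases hy with h | h <;> simp [h]
  have hiy : IsInducedPath T (y :: t) := by
    rcases hy with h | h <;> rw [h]
    exacts [hP.1.1 _ hly, (hP.1.1 _ hly).reverse hT]
  have hdeg : T.degree (ly.headD r) = T.degree y := by
    have := hiso.degree_headD_reverse hT hP hly r
    rcases hy with h | h <;> rw [← h] at this
    · rw [← h]; rfl
    · exact this.symm
  have hix := (hT.isInducedPath_iff _).1 (hP.1.1 _ hlx)
  rw [hT.isInducedPath_iff] at hiy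
  have hxch := List.isChain_split.1 hix.2.2
  have hcross := hP.1.2.2 _ hlx ly hly hne
  obtain ⟨hnA, hnB, hAB⟩ := List.nodup_append'.1 hix.2.1
  have hind₁ : IsInducedPath T (A ++ x :: y :: t) := by
    rw [hT.isInducedPath_iff]
    refine ⟨by simp, ?_, List.isChain_append_cons_cons.2 ⟨hxch.1, hxy, hiy.2.2⟩⟩
    have : (A ++ [x] ++ y :: t).Nodup := by
      refine List.Nodup.append ?_ hiy.2.1 ?_
      · refine hix.2.1.sublist ?_
        simp
      · intro v hv hv'
        refine hcross v ?_ ((hymem v).1 hv')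
        simp only [List.mem_append, List.mem_cons, List.not_mem_nil, or_false] at hv ⊢
        tauto
    simpa using this
  have hind₂ : IsInducedPath T B.reverse := by
    refine IsInducedPath.reverse hT ((hT.isInducedPath_iff _).2 ⟨hB, ?_, hxch.2.tail⟩)
    exact (List.nodup_cons.1 hnB).2
  have hd : ∀ v, v ∈ A ++ x :: y :: t → v ∉ B.reverse := by
    intro v hv hvB
    rw [List.mem_reverse] at hvB
    rw [List.mem_append, List.mem_cons] at hv
    rcases hv with hv | rfl | hv
    · exact hAB hv (List.mem_cons_of_mem _ hvB)
    · exact (List.nodup_cons.1 hnB).1 hvB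
    · exact hcross v (by simp [hvB]) ((hymem v).1 hv)
  have hne' : A ++ x :: y :: t ≠ B.reverse := by
    intro h
    exact hd x (by simp) (by simp [← h])
  have key := hiso.sum_degree_exchange hT hP (R := {A ++ x :: B, ly})
    (R' := {A ++ x :: y :: t, B.reverse}) (by simp [Finset.insert_subset_iff, hlx, hly])
    (by simpa using ⟨hind₁, hind₂⟩)
    (by
      intro l hl l' hl' hll v hv hv'
      simp only [Finset.mem_insert, Finset.mem_singleton] at hl hl'
      rcases hl with rfl | rfl <;> rcases hl' with rfl | rfl
      · exact hll rfl
      · exact hd v hv hv'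
      · exact hd v hv' hv
      · exact hll rfl)
    (by
      intro v
      have h2 := hymem v
      simp only [List.mem_cons] at h2
      simp only [Finset.mem_insert, Finset.mem_singleton, exists_eq_or_imp, exists_eq_left,
        List.mem_append, List.mem_cons, List.mem_reverse, ← h2]
      tauto)
    (by rw [Finset.card_pair hne, Finset.card_pair hne']) r
  rw [Finset.sum_pair hne, Finset.sum_pair hne', hdeg] at key
  obtain ⟨a, A', rfl⟩ := List.exists_cons_of_ne_nil hA
  obtain ⟨b, B', hB'⟩ := List.exists_cons_of_ne_nil (l := B.reverse) (by simpa using hB)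
  have hrev : ((a :: A') ++ x :: B).reverse.headD r = B.reverse.headD r := by simp [hB']
  change T.degree a + T.degree (B.reverse.headD r) = T.degree a + T.degree y at key
  rw [hrev]
  omega

omit [Fintype V] [DecidableEq V] [DecidableRel T.Adj] in
theorem exists_cons_of_not_interior {l A B : List V} {x : V} (hl : l = A ++ x :: B)
    (h : A = [] ∨ B = []) : ∃ t, x :: t = l ∨ x :: t = l.reverse := by
  rcases h with rfl | rfl
  · exact ⟨B, .inl (by simp [hl])⟩
  · exact ⟨A.reverse, .inr (by simp [hl])⟩

theorem IsoUniqueZF.eq_nil_of_adj_interior (hT : T.IsTree) (hiso : IsoUniqueZF T)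
    {P : Finset (List V)} (hP : IsMinPathCover T P) {A B ly t : List V} {x y : V}
    (hA : A ≠ []) (hB : B ≠ []) (hlx : A ++ x :: B ∈ P) (hly : ly ∈ P)
    (hne : A ++ x :: B ≠ ly) (hy : y :: t = ly ∨ y :: t = ly.reverse) (hxy : T.Adj x y) :
    t = [] := by
  by_contra ht
  refine false_of_unbounded_dist (T.dist y) (fun u w ↦ T.Adj u w ∧ T.dist y w = T.dist y u + 1 ∧
    ∃ A B l t, A ≠ [] ∧ B ≠ [] ∧ A ++ w :: B ∈ P ∧ l ∈ P ∧ A ++ w :: B ≠ l ∧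
      (u :: t = l ∨ u :: t = l.reverse) ∧ t ≠ []) ?_ ?_
  · exact ⟨y, x, hxy.symm, by simp [SimpleGraph.dist_eq_one_iff_adj.2 hxy.symm],
      A, B, ly, t, hA, hB, hlx, hly, hne, hy, ht⟩
  · clear! A B ly t
    rintro u w ⟨huw, hd, A, B, l, t, hA, hB, hlw, hl, hne, hu, ht⟩
    have humem : ∀ v, v ∈ u :: t ↔ v ∈ l := by rcases hu with h | h <;> simp [h]
    have hiu : IsInducedPath T (u :: t) := by
      rcases hu with h | h <;> rw [h]
      exacts [hP.1.1 _ hl, (hP.1.1 _ hl).reverse hT]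
    have hcross := hP.1.2.2 _ hlw l hl hne
    have hdeg : 1 < T.degree u := by
      obtain ⟨c, t', rfl⟩ := List.exists_cons_of_ne_nil ht
      have huc : T.Adj u c :=
        (List.isChain_cons_cons.1 ((hT.isInducedPath_iff _).1 hiu).2.2).1
      rw [← SimpleGraph.card_neighborFinset_eq_degree, Finset.one_lt_card]
      refine ⟨w, by simpa using huw, c, by simpa using huc, ?_⟩
      rintro rfl
      exact hcross w (by simp) ((humem w).1 (by simp))
    have hdeg' := hiso.degree_last_eq hT hP hA hB hlw hl hne hu huw.symm y
    obtain ⟨b, B', hB'⟩ := List.exists_cons_of_ne_nil (l := B.reverse) (by simpa using hB)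
    have hrev : (A ++ w :: B).reverse = b :: (B' ++ w :: A.reverse) := by simp [hB']
    have hir : IsInducedPath T (b :: (B' ++ w :: A.reverse)) := by
      rw [← hrev]; exact (hP.1.1 _ hlw).reverse hT
    rw [hrev, List.headD_cons] at hdeg'
    rw [← hdeg', ← SimpleGraph.card_neighborFinset_eq_degree] at hdeg
    set m := b :: (B' ++ w :: A.reverse) with hm
    have hlen : 1 < m.length := by simp [hm]
    obtain ⟨w', hw', hw'ne⟩ := Finset.exists_mem_ne hdeg m[1]
    rw [SimpleGraph.mem_neighborFinset] at hw'
    have hw'm : w' ∉ m := by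
      intro h
      obtain ⟨i, hi, rfl⟩ := List.getElem_of_mem h
      have hw0 : T.Adj m[0] m[i] := hw'
      rcases hir.index_of_adj (by omega) hi hw0 with rfl | h
      · exact hw'ne rfl
      · omega
    have hmmem : ∀ v, v ∈ m ↔ v ∈ A ++ w :: B := by
      intro v; rw [← hrev, List.mem_reverse]
    have hum : u ∉ m := fun h ↦ hcross u ((hmmem u).1 h) ((humem u).1 (by simp))
    have hfar := exists_lt_dist_of_path hT hir huw hum hd (k := B'.length + 1) (j := 0)
      (by simp [hm]) (by simp [hm]) (by omega) hw' hw'm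
    obtain ⟨l', hl', hwl'⟩ := hP.1.2.1 w'
    obtain ⟨A₁, B₁, hl'eq⟩ := List.append_of_mem hwl'
    have hne' : A ++ w :: B ≠ l' := by
      rintro rfl
      exact hw'm ((hmmem w').2 hwl')
    have hend : ¬ (A₁ = [] ∨ B₁ = []) := by
      intro h
      obtain ⟨s, hs⟩ := exists_cons_of_not_interior hl'eq h
      refine hP.not_adj_ends hT (s := A ++ w :: B'.reverse) hlw hl' hne' (.inl ?_) hs hw'
      rw [← List.reverse_inj, hrev]
      simp [hm]
    push Not at hend
    refine ⟨b, w', ⟨hw', hfar.1, A₁, B₁, A ++ w :: B, B' ++ w :: A.reverse, hend.1, hend.2,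
      hl'eq ▸ hl', hlw, hl'eq ▸ hne'.symm, .inr hrev.symm, by simp⟩, hfar.2⟩

omit [Fintype V] [DecidableEq V] [DecidableRel T.Adj] in
theorem interiorIn_of_append {P : Finset (List V)} (hP : ∀ l ∈ P, l.Nodup) {A B : List V} {x : V}
    (h : A ++ x :: B ∈ P) (hA : A ≠ []) (hB : B ≠ []) : InteriorIn P x := by
  have hn := hP _ h
  obtain ⟨a, A, rfl⟩ := List.exists_cons_of_ne_nil hA
  refine ⟨_, h, by simp, by simp, ?_, ?_⟩
  · rintro rfl
    simp at hn
  · intro hx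
    rw [List.getLast_append_of_ne_nil _ (by simp), List.getLast_cons hB] at hx
    have := List.getLast_mem hB
    rw [← hx] at this
    simp [List.nodup_append', this] at hn

end

/-- If a finite tree `T` is an iso-unique zero forcing graph, `P` is a minimum path cover
of `T` and `xy` is a connector edge of `P`, then either both connector vertices `x` and
`y` are interior, or one of them is interior and the other is the only vertex of a
one-vertex path of `P`. -/
theorem connector_edge_interior_or_single {V : Type*} [Fintype V] [DecidableEq V]
    (T : SimpleGraph V) (hT : T.IsTree) (hiso : IsoUniqueZF T)
    (P : Finset (List V)) (hP : IsMinPathCover T P)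
    (x y : V) (hxy : T.Adj x y)
    (lx ly : List V) (hlx : lx ∈ P) (hly : ly ∈ P)
    (hx : x ∈ lx) (hy : y ∈ ly) (hne : lx ≠ ly) :
    (InteriorIn P x ∧ InteriorIn P y) ∨
    (InteriorIn P x ∧ [y] ∈ P) ∨
    (InteriorIn P y ∧ [x] ∈ P) := by
  classical
  have hnd : ∀ l ∈ P, l.Nodup := fun l hl ↦ (hP.1.1 l hl).2.1
  obtain ⟨A, B, rfl⟩ := List.append_of_mem hx
  obtain ⟨C, D, rfl⟩ := List.append_of_mem hy
  by_cases hAB : A = [] ∨ B = [] <;> by_cases hCD : C = [] ∨ D = []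
  · obtain ⟨s, hs⟩ := exists_cons_of_not_interior rfl hAB
    obtain ⟨t, ht⟩ := exists_cons_of_not_interior rfl hCD
    refine (hP.not_adj_ends hT (s := s.reverse) hlx hly hne ?_ ht hxy).elim
    rw [← List.reverse_cons]
    rcases hs with h | h
    · exact .inr (by rw [h])
    · exact .inl (by rw [h, List.reverse_reverse])
  · push Not at hCD
    obtain ⟨s, hs⟩ := exists_cons_of_not_interior rfl hAB
    obtain rfl := hiso.eq_nil_of_adj_interior hT hP hCD.1 hCD.2 hly hlx hne.symm hs hxy.symm
    refine .inr (.inr ⟨interiorIn_of_append hnd hly hCD.1 hCD.2, ?_⟩)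
    rcases hs with h | h
    · rwa [h]
    · rwa [← List.reverse_reverse (A ++ x :: B), ← h] at hlx
  · push Not at hAB
    obtain ⟨t, ht⟩ := exists_cons_of_not_interior rfl hCD
    obtain rfl := hiso.eq_nil_of_adj_interior hT hP hAB.1 hAB.2 hlx hly hne ht hxy
    refine .inr (.inl ⟨interiorIn_of_append hnd hlx hAB.1 hAB.2, ?_⟩)
    rcases ht with h | h
    · rwa [h]
    · rwa [← List.reverse_reverse (C ++ y :: D), ← h] at hly
  · push Not at hAB hCD
    exact .inl ⟨interiorIn_of_append hnd hlx hAB.1 hAB.2, interiorIn_of_append hnd hly hCD.1 hCD.2⟩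
end

section
/- A finite simple graph G has exactly one L-Grundy dominating set if and only if γ_gr^L(G) = n(G), where n(G) is the number of vertices of G. -/
/-- An L-sequence in `G`: a list of distinct vertices such that each vertex has a vertex
in its closed neighborhood which is not in the open neighborhood of any earlier
vertex. -/
def IsLSeq {V : Type*} (G : SimpleGraph V) (l : List V) : Prop :=
  l.Nodup ∧ ∀ i : Fin l.length, ∃ w : V, (w = l.get i ∨ G.Adj (l.get i) w) ∧
    ∀ j : Fin l.length, (j : ℕ) < (i : ℕ) → ¬ G.Adj (l.get j) w

/-- The L-Grundy domination number of `G`: the maximum length of an L-sequence. -/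
noncomputable def grundyLNum {V : Type*} (G : SimpleGraph V) : ℕ :=
  sSup {k : ℕ | ∃ l : List V, IsLSeq G l ∧ l.length = k}

/-- An L-Grundy dominating sequence: an L-sequence of maximum length. -/
def IsLGrundyDomSeq {V : Type*} (G : SimpleGraph V) (l : List V) : Prop :=
  IsLSeq G l ∧ ∀ l' : List V, IsLSeq G l' → l'.length ≤ l.length

/-- An L-Grundy dominating set of `G`: the set of vertices of some L-Grundy dominating
sequence of `G`. -/
def IsLGrundyDomSet {V : Type*} (G : SimpleGraph V) (A : Set V) : Prop :=
  ∃ l : List V, IsLGrundyDomSeq G l ∧ {v : V | v ∈ l} = A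

theorem isLSeq_iff_getElem {V : Type*} (G : SimpleGraph V) (l : List V) :
    IsLSeq G l ↔ l.Nodup ∧ ∀ (i : ℕ) (hi : i < l.length), ∃ w : V, (w = l[i] ∨ G.Adj l[i] w) ∧
      ∀ (j : ℕ) (hj : j < i), ¬ G.Adj l[j] w := by
  refine and_congr_right fun _ => ⟨fun h i hi => ?_, fun h i => ?_⟩
  · obtain ⟨w, hw, hw'⟩ := h ⟨i, hi⟩
    exact ⟨w, hw, fun j hj => hw' ⟨j, hj.trans hi⟩ hj⟩
  · obtain ⟨w, hw, hw'⟩ := h i i.2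
    exact ⟨w, hw, fun j hj => hw' j hj⟩

/-- A vertex outside an L-Grundy dominating sequence has its closed neighborhood covered by the
open neighborhoods of the sequence. -/
theorem IsLGrundyDomSeq.exists_adj_of_notMem {V : Type*} {G : SimpleGraph V} {l : List V}
    (hl : IsLGrundyDomSeq G l) {u : V} (hu : u ∉ l) {w : V} (hw : w = u ∨ G.Adj u w) :
    ∃ (j : ℕ) (hj : j < l.length), G.Adj l[j] w := by
  by_contra! hcov
  have hseq : IsLSeq G (l ++ [u]) := by
    obtain ⟨hnd, hfoot⟩ := (isLSeq_iff_getElem G l).1 hl.1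
    refine (isLSeq_iff_getElem G _).2 ⟨by simpa [List.nodup_append] using ⟨hnd, by grind⟩, ?_⟩
    intro i hi
    rcases Nat.lt_or_ge i l.length with hil | hil
    · obtain ⟨w', hw', hw''⟩ := hfoot i hil
      exact ⟨w', by grind, by grind⟩
    · obtain rfl : i = l.length := by grind
      exact ⟨w, by grind, by grind⟩
  have := hl.2 _ hseq
  grind

/-- A vertex outside an L-Grundy dominating sequence can be exchanged with some vertex of it. -/
theorem IsLGrundyDomSeq.exists_set {V : Type*} {G : SimpleGraph V} {l : List V}
    (hl : IsLGrundyDomSeq G l) {u : V} (hu : u ∉ l) :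
    ∃ i < l.length, IsLGrundyDomSeq G (l.set i u) := by
  classical
  have hex : ∃ n, ∀ w, (w = u ∨ G.Adj u w) →
      ∃ (j : ℕ) (hj : j < l.length), j < n ∧ G.Adj l[j] w :=
    ⟨l.length, fun w hw => by
      obtain ⟨j, hj, h⟩ := hl.exists_adj_of_notMem hu hw
      exact ⟨j, hj, hj, h⟩⟩
  obtain ⟨hcov, hmin⟩ := And.intro (Nat.find_spec hex) (fun m => Nat.find_min hex (m := m))
  generalize Nat.find hex = n at hcov hmin
  obtain ⟨j₀, -, hj₀, -⟩ := hcov u (Or.inl rfl)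
  obtain ⟨k, rfl⟩ : ∃ k, n = k + 1 := ⟨n - 1, by omega⟩
  obtain ⟨w, hw, hwk⟩ : ∃ w, (w = u ∨ G.Adj u w) ∧
      ∀ (j : ℕ) (hj : j < l.length), j < k → ¬ G.Adj l[j] w := by
    have h := hmin k k.lt_succ_self
    push Not at h
    obtain ⟨w, hw, h⟩ := h
    exact ⟨w, hw, h⟩
  have hk : k < l.length := by
    obtain ⟨j, hj, hjk, h⟩ := hcov w hw
    have := hwk j hj
    grind
  obtain ⟨hnd, hfoot⟩ := (isLSeq_iff_getElem G l).1 hl.1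
  refine ⟨k, hk, (isLSeq_iff_getElem G _).2 ⟨?_, fun i hi => ?_⟩, by simpa using hl.2⟩
  · rw [List.nodup_iff_pairwise_ne, List.pairwise_iff_getElem] at hnd ⊢
    grind
  · rw [List.length_set] at hi
    rcases lt_trichotomy i k with hik | rfl | hik
    · obtain ⟨w', hw', hw''⟩ := hfoot i hi
      exact ⟨w', by grind, by grind⟩
    · exact ⟨w, by grind, by grind⟩
    · obtain ⟨w', hw', hw''⟩ := hfoot i hi
      refine ⟨w', by grind, fun j hj => ?_⟩
      rw [List.getElem_set]
      split_ifs with hkj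
      · intro hadj
        obtain ⟨m, hm, hmk, h⟩ := hcov w' (Or.inr hadj)
        exact hw'' m (by omega) h
      · exact hw'' j hj

theorem IsLSeq.length_le_card {V : Type*} [Fintype V] {G : SimpleGraph V} {l : List V}
    (hl : IsLSeq G l) : l.length ≤ Fintype.card V :=
  hl.1.length_le_card

theorem bddAbove_length_isLSeq {V : Type*} [Fintype V] (G : SimpleGraph V) :
    BddAbove {k : ℕ | ∃ l : List V, IsLSeq G l ∧ l.length = k} :=
  ⟨Fintype.card V, by rintro _ ⟨l, hl, rfl⟩; exact hl.length_le_card⟩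

theorem IsLSeq.length_le_grundyLNum {V : Type*} [Fintype V] {G : SimpleGraph V} {l : List V}
    (hl : IsLSeq G l) : l.length ≤ grundyLNum G :=
  le_csSup (bddAbove_length_isLSeq G) ⟨l, hl, rfl⟩

theorem exists_isLSeq_length_eq_grundyLNum {V : Type*} [Fintype V] (G : SimpleGraph V) :
    ∃ l : List V, IsLSeq G l ∧ l.length = grundyLNum G :=
  Nat.sSup_mem (s := {k : ℕ | ∃ l : List V, IsLSeq G l ∧ l.length = k})
    ⟨0, [], by simp [IsLSeq], rfl⟩ (bddAbove_length_isLSeq G)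

theorem IsLGrundyDomSeq.length_eq {V : Type*} [Fintype V] {G : SimpleGraph V} {l : List V}
    (hl : IsLGrundyDomSeq G l) : l.length = grundyLNum G := by
  obtain ⟨l', hl', h⟩ := exists_isLSeq_length_eq_grundyLNum G
  exact le_antisymm hl.1.length_le_grundyLNum (h ▸ hl.2 l' hl')

/-- A duplicate-free list has as many entries as there are vertices iff it contains all of them. -/
theorem List.Nodup.length_eq_card_iff {V : Type*} [Fintype V] {l : List V} (hl : l.Nodup) :
    l.length = Fintype.card V ↔ ∀ v, v ∈ l := by
  classical
  rw [← List.toFinset_card_of_nodup hl, Finset.card_eq_iff_eq_univ, Finset.eq_univ_iff_forall]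
  simp

/-- A finite graph `G` has exactly one L-Grundy dominating set iff its L-Grundy
domination number equals its number of vertices. -/
theorem unique_LGrundyDomSet_iff {V : Type*} [Fintype V] (G : SimpleGraph V) :
    (∃! A : Set V, IsLGrundyDomSet G A) ↔ grundyLNum G = Fintype.card V := by
  constructor
  · rintro ⟨_, ⟨l, hl, rfl⟩, huniq⟩
    rw [← hl.length_eq, hl.1.1.length_eq_card_iff]
    by_contra! ⟨u, hu⟩
    obtain ⟨i, hi, hset⟩ := hl.exists_set hu
    have h : u ∈ {v | v ∈ l.set i u} := List.mem_set hi u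
    rw [huniq _ ⟨_, hset, rfl⟩] at h
    exact hu h
  · intro hcard
    obtain ⟨l, hl, hlen⟩ := exists_isLSeq_length_eq_grundyLNum G
    have huniv {l : List V} (hl : IsLSeq G l) (hlen : l.length = grundyLNum G) :
        {v | v ∈ l} = Set.univ :=
      Set.eq_univ_of_forall (hl.1.length_eq_card_iff.1 (hlen.trans hcard))
    refine ⟨Set.univ, ⟨l, ⟨hl, fun l' hl' => ?_⟩, huniv hl hlen⟩, ?_⟩
    · exact hlen ▸ hl'.length_le_grundyLNum
    · rintro _ ⟨l', hl', rfl⟩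
      exact huniv hl'.1 hl'.length_eq
end
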